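/- Let 𝒳 be a regular scheme over S = Spec R with R the ring of integers of a local number field F, 𝔮 its maximal ideal, and residue field F_𝔮 of cardinality q. Let ω be a gauge form on 𝒳 and dμ_ω the associated Weil p-adic measure. Let φ: 𝒳(R) → 𝒳(F_𝔮) be the reduction map sending an R-integral point to its closed point over the residue field. Then for every closed F_𝔮-point x̄ of 𝒳, the fiber φ^{-1}(x̄) satisfies ∫_{φ^{-1}(x̄)} dμ_ω = 1/q^n, where n is the relative dimension of 𝒳 over S. -/

import Mathlib

/-!
STATEMENT 8: Let 𝒳 be a regular scheme over S = Spec R with R the ring of integers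
of a local number field F, 𝔮 its maximal ideal, residue field F_𝔮 of cardinality q.
Let ω be a gauge form on 𝒳 and dμ_ω the associated Weil p-adic measure. Let
φ: 𝒳(R) → 𝒳(F_𝔮) be the reduction map. Then for every closed F_𝔮-point x̄ of 𝒳,
∫_{φ⁻¹(x̄)} dμ_ω = 1/qⁿ, where n is the relative dimension of 𝒳 over S.
-/

open AlgebraicGeometry CategoryTheory Opposite MeasureTheory

universe u

noncomputable section

namespace BirGeo

/-- Transfer of (exterior-algebra valued) differential forms along a morphism of
`R`-algebras `A → B`: the natural map `⋀ Ω[A⁄R] → ⋀ Ω[B⁄R]` induced by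
functoriality of Kähler differentials. -/
noncomputable def formTransfer (R A B : Type u) [CommRing R] [CommRing A] [CommRing B]
    [Algebra R A] [Algebra R B] [Algebra A B] [IsScalarTower R A B] :
    ExteriorAlgebra A (Ω[A⁄R]) → ExteriorAlgebra B (Ω[B⁄R]) :=
  letI : Algebra A (ExteriorAlgebra B (Ω[B⁄R])) :=
    Algebra.compHom (ExteriorAlgebra B (Ω[B⁄R])) (algebraMap A B)
  letI : @IsScalarTower A B (ExteriorAlgebra B (Ω[B⁄R])) _ _ Algebra.toSMul :=
    IsScalarTower.of_algebraMap_eq' rfl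
  fun w =>
    ExteriorAlgebra.lift A
      ⟨(LinearMap.restrictScalars A
          (ExteriorAlgebra.ι B (M := Ω[B⁄R]))).comp (KaehlerDifferential.map R R A B),
        fun m => by
          simp [ExteriorAlgebra.ι_sq_zero (R := B) ((KaehlerDifferential.map R R A B) m)]⟩ w

variable (k : CommRingCat.{u}) (X : Scheme.{u}) [X.Over (Spec k)]

/-- The canonical ring homomorphism from the base ring `k` to the ring of sections
over an open `U` of a scheme `X` over `Spec k`. -/
noncomputable def secHom (U : X.Opens) : ↥k →+* ↥Γ(X, U) :=
  ((Scheme.ΓSpecIso k).inv ≫ (X ↘ Spec k).appTop ≫ X.presheaf.map (homOfLE le_top).op :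
    k ⟶ Γ(X, U)).hom

/-- The `k`-algebra structure on sections of a scheme over `Spec k`. -/
noncomputable def secAlgebra (U : X.Opens) : Algebra ↥k ↥Γ(X, U) :=
  (secHom k X U).toAlgebra

/-- Algebraic differential forms on an open `U` of a scheme `X` over `Spec k`:
the exterior algebra of the module of Kähler differentials of `Γ(X, U)` over `k`. -/
noncomputable def FormsOn (U : X.Opens) : Type u :=
  letI := secAlgebra k X U
  ExteriorAlgebra ↥Γ(X, U) (Ω[↥Γ(X, U)⁄↥k])

/-- `w` is a differential form of degree `n` on `U`, i.e. lies in the `n`-th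
exterior power of the Kähler differentials. -/
noncomputable def FormsOn.IsDegree (n : ℕ) (U : X.Opens) (w : FormsOn k X U) : Prop :=
  letI := secAlgebra k X U
  w ∈ ⋀[↥Γ(X, U)]^n (Ω[↥Γ(X, U)⁄↥k])

/-- The degree `n` form `w` on `U` generates the module of degree `n` forms on `U`
(equivalently, the section `w` of the line bundle `Ω^n` trivializes it over `U`,
i.e. has no zeros on `U`). -/
noncomputable def FormsOn.Generates (n : ℕ) (U : X.Opens) (w : FormsOn k X U) : Prop :=
  letI := secAlgebra k X U
  let w' : ExteriorAlgebra ↥Γ(X, U) (Ω[↥Γ(X, U)⁄↥k]) := w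
  (⋀[↥Γ(X, U)]^n (Ω[↥Γ(X, U)⁄↥k]) : Submodule ↥Γ(X, U) _) ≤
    Submodule.span ↥Γ(X, U) {w'}

variable {X} in
/-- Pullback of differential forms along a morphism `g : Z ⟶ X` of schemes over
`Spec k`, from an open `U ⊆ X` to an open `W ⊆ Z` with `W ≤ g⁻¹(U)`.
Taking `g = 𝟙 X` gives restriction of forms to smaller opens. -/
noncomputable def formPullback {Z : Scheme.{u}} [Z.Over (Spec k)]
    (g : Z ⟶ X) (hg : g ≫ (X ↘ Spec k) = Z ↘ Spec k)
    (U : X.Opens) (W : Z.Opens) (e : W ≤ g ⁻¹ᵁ U) :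
    FormsOn k X U → FormsOn k Z W :=
  letI := secAlgebra k X U
  letI := secAlgebra k Z W
  letI : Algebra ↥Γ(X, U) ↥Γ(Z, W) := RingHom.toAlgebra (g.appLE U W e : Γ(X, U) ⟶ Γ(Z, W)).hom
  letI : IsScalarTower ↥k ↥Γ(X, U) ↥Γ(Z, W) := IsScalarTower.of_algebraMap_eq' (by
    show secHom k Z W = RingHom.comp (g.appLE U W e : Γ(X, U) ⟶ Γ(Z, W)).hom (secHom k X U)
    have h : ((Scheme.ΓSpecIso k).inv ≫ (Z ↘ Spec k).appTop ≫
          Z.presheaf.map (homOfLE le_top).op : k ⟶ Γ(Z, W))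
        = (Scheme.ΓSpecIso k).inv ≫ (X ↘ Spec k).appTop ≫
          X.presheaf.map (homOfLE le_top).op ≫ g.appLE U W e := by
      rw [← hg]
      rw [Scheme.Hom.map_appLE, Scheme.Hom.comp_appTop, Category.assoc]
      rfl
    exact congrArg CommRingCat.Hom.hom h)
  formTransfer ↥k ↥Γ(X, U) ↥Γ(Z, W)

/-- A gauge form of degree `n` on a scheme `X` over `Spec k`: a nowhere vanishing
global section of the sheaf `Ω^n_{X/k}` of degree `n` differential forms, given as a
compatible family of degree `n` forms on all affine opens, generating the sheaf of
degree `n` forms everywhere. The canonical line bundle `Ω^n_X` of a smooth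
`n`-dimensional `X` is trivial if and only if a gauge form of degree `n` exists. -/
structure GaugeForm (n : ℕ) : Type u where
  form : ∀ U : X.Opens, IsAffineOpen U → FormsOn k X U
  isDegree : ∀ U hU, FormsOn.IsDegree k X n U (form U hU)
  compat : ∀ (U V : X.Opens) (hU : IsAffineOpen U) (hV : IsAffineOpen V) (e : V ≤ U),
    formPullback k (𝟙 X) (Category.id_comp _) U V (by simpa using e) (form U hU) = form V hV
  generates : ∀ U hU, FormsOn.Generates k X n U (form U hU)

variable {X} in
/-- Multiplication of a differential form on `U` by an invertible regular function. -/
noncomputable def FormsOn.unitSMul (U : X.Opens) (u : (↥Γ(X, U))ˣ) (w : FormsOn k X U) :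
    FormsOn k X U :=
  letI := secAlgebra k X U
  let w' : ExteriorAlgebra ↥Γ(X, U) (Ω[↥Γ(X, U)⁄↥k]) := w
  (u : ↥Γ(X, U)) • w'

/-- Given morphisms `α : Z ⟶ X` and `β : Z ⟶ Y` of schemes over `Spec k` (with `Z`,
`X`, `Y` integral and smooth), the pullbacks of the canonical line bundles agree:
`β^*Ω^n_Y ≅ α^*Ω^n_X`.  This is expressed by saying that near every point of `Z`
the pullbacks of local trivialisations (local gauge forms) of `Ω^n_X` and `Ω^n_Y`
differ by an invertible regular function. -/
def PullbacksOfCanonicalAgree (n : ℕ) {X Y Z : Scheme.{u}}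
    [X.Over (Spec k)] [Y.Over (Spec k)] [Z.Over (Spec k)]
    (α : Z ⟶ X) (hα : α ≫ (X ↘ Spec k) = Z ↘ Spec k)
    (β : Z ⟶ Y) (hβ : β ≫ (Y ↘ Spec k) = Z ↘ Spec k) : Prop :=
  ∀ z : Z, ∃ (W : Z.Opens) (_ : z ∈ W) (U : X.Opens) (V : Y.Opens)
      (eU : W ≤ α ⁻¹ᵁ U) (eV : W ≤ β ⁻¹ᵁ V)
      (ωU : FormsOn k X U) (ωV : FormsOn k Y V),
    FormsOn.IsDegree k X n U ωU ∧ FormsOn.Generates k X n U ωU ∧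
    FormsOn.IsDegree k Y n V ωV ∧ FormsOn.Generates k Y n V ωV ∧
    ∃ u : (↥Γ(Z, W))ˣ,
      formPullback k α hα U W eU ωU =
        FormsOn.unitSMul k W u (formPullback k β hβ V W eV ωV)

/-- The set of `k`-rational points of a scheme `X` over `Spec k`:
sections of the structure morphism. -/
def SchemeSection : Type u :=
  { s : Spec k ⟶ X // s ≫ (X ↘ Spec k) = 𝟙 (Spec k) }

/-- Evaluation of a regular function `g ∈ Γ(X, U)` at a `k`-point `s` lying in `U`. -/
noncomputable def secEval (s : SchemeSection k X) (U : X.Opens)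
    (h : ∀ pt, s.val.base pt ∈ U) (g : Γ(X, U)) : ↥k :=
  (Scheme.ΓSpecIso k).hom
    ((Spec k).presheaf.map (homOfLE (fun pt _ => h pt : (⊤ : (Spec k).Opens) ≤ s.val ⁻¹ᵁ U)).op
      (s.val.app U g))

/-- The topology on the set of `k`-points of `X`, for a topological ring `k`: the
topology generated by preimages of open sets under evaluation of regular functions
(for `k = ℂ` this is the analytic topology, for `k` a `p`-adic field the `p`-adic one). -/
def sectionTopology [TopologicalSpace ↥k] : TopologicalSpace (SchemeSection k X) :=
  TopologicalSpace.generateFrom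
    { T | ∃ (U : X.Opens) (g : Γ(X, U)) (W : Set ↥k), IsOpen W ∧
        T = { s : SchemeSection k X | ∃ h : ∀ pt, s.val.base pt ∈ U, secEval k X s U h g ∈ W } }

section LocalField

variable (F : Type) [NontriviallyNormedField F] [IsUltrametricDist F]

/-- The ring of integers (maximal compact subring) `R = {x : ‖x‖ ≤ 1}` of a
nonarchimedean field. -/
noncomputable def integerRing : Subring F where
  carrier := { x : F | ‖x‖ ≤ 1 }
  one_mem' := by simp
  mul_mem' := fun {a b} ha hb => by
    simpa [norm_mul] using mul_le_one₀ ha (norm_nonneg b) hb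
  zero_mem' := by simp
  add_mem' := fun {a b} ha hb =>
    le_trans (IsUltrametricDist.norm_add_le_max a b) (max_le ha hb)
  neg_mem' := fun {a} ha => by simpa using ha

/-- The maximal ideal `𝔮 = {x : ‖x‖ < 1}` of the ring of integers of a
nonarchimedean field. -/
noncomputable def maximalIdeal : Ideal ↥(integerRing F) where
  carrier := { x : ↥(integerRing F) | ‖(x : F)‖ < 1 }
  zero_mem' := by simp
  add_mem' := fun {a b} ha hb =>
    lt_of_le_of_lt (IsUltrametricDist.norm_add_le_max (a : F) (b : F)) (max_lt ha hb)
  smul_mem' := fun c x hx => by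
    have h1 : ‖((c * x : ↥(integerRing F)) : F)‖ = ‖(c : F)‖ * ‖(x : F)‖ := by
      push_cast
      exact norm_mul _ _
    have h2 : ‖(c : F)‖ * ‖(x : F)‖ ≤ 1 * ‖(x : F)‖ :=
      mul_le_mul_of_nonneg_right c.2 (norm_nonneg (x : F))
    simpa [smul_eq_mul, h1] using lt_of_le_of_lt (le_trans h2 (le_of_eq (one_mul _))) hx

/-- The residue field `F_𝔮 = R/𝔮` of a nonarchimedean field. -/
noncomputable def residueRing : Type :=
  ↥(integerRing F) ⧸ maximalIdeal F

noncomputable instance : CommRing (residueRing F) :=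
  inferInstanceAs (CommRing (↥(integerRing F) ⧸ maximalIdeal F))

/-- The ring of integers, as an object of the category of commutative rings. -/
noncomputable def RCat : CommRingCat.{0} := CommRingCat.of ↥(integerRing F)

/-- The reduction map `R → R/𝔮`, as a morphism of the category of commutative
rings. -/
noncomputable def residueCat : RCat F ⟶ CommRingCat.of (residueRing F) :=
  CommRingCat.ofHom (Ideal.Quotient.mk (maximalIdeal F))

end LocalField

section Charts

open MeasureTheory

variable [TopologicalSpace ↥k]

/-- The Borel σ-algebra on the topological space of `k`-points of `X`. -/
noncomputable def sectionMeasurableSpace : MeasurableSpace (SchemeSection k X) :=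
  @borel _ (sectionTopology k X)

variable {X} (n : ℕ)

/-- The `i`-th coordinate function of a chart `g : 𝒱 ⟶ 𝔸ⁿ`, as a regular function
on the open subscheme `𝒱` of `X`. -/
noncomputable def chartCoord {𝒱 : X.Opens} (g : 𝒱.toScheme ⟶ 𝔸(ULift.{u} (Fin n); Spec k)) (i : Fin n) :
    ↥Γ(X, 𝒱) :=
  𝒱.topIso.hom (g.appTop (AffineSpace.coord (S := Spec k) (ULift.up i)))

/-- The map on `k`-points induced by a chart `g : 𝒱 ⟶ 𝔸ⁿ`: a point of `X` lying in
`𝒱` is sent to the values of the `n` coordinate functions of the chart at the point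
(and points not lying in `𝒱` are sent to the junk value `0`). -/
noncomputable def chartMap {𝒱 : X.Opens} (g : 𝒱.toScheme ⟶ 𝔸(ULift.{u} (Fin n); Spec k)) :
    SchemeSection k X → (Fin n → ↥k) := fun s =>
  letI := Classical.propDecidable
  if h : ∀ pt, s.val.base pt ∈ 𝒱 then fun i => secEval k X s 𝒱 h (chartCoord k n g i) else 0

/-- The pullback `g^*(dt₁ ∧ ⋯ ∧ dtₙ)` of the standard gauge form on `𝔸ⁿ` under a
chart `g : 𝒱 ⟶ 𝔸ⁿ`: the wedge product of the differentials of the `n` coordinate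
functions of the chart. -/
noncomputable def chartWedge {𝒱 : X.Opens} (g : 𝒱.toScheme ⟶ 𝔸(ULift.{u} (Fin n); Spec k)) :
    FormsOn k X 𝒱 :=
  letI := secAlgebra k X 𝒱
  (List.ofFn fun i : Fin n =>
    ExteriorAlgebra.ι ↥Γ(X, 𝒱) ((KaehlerDifferential.D ↥k ↥Γ(X, 𝒱)) (chartCoord k n g i))).prod

end Charts

section WeilMeasure

open MeasureTheory

variable [TopologicalSpace ↥k]

variable {X} in
/-- `μ` is the Weil `p`-adic measure `dμ_ω` associated with the gauge form `ω`, on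
the space `X(R)` of `R`-integral points of `X` (`ν` being the Haar measure on `Rⁿ`
normalized so that `ν(Rⁿ) = 1`, and `normF` the `p`-adic norm of the field): in any
étale chart `g : 𝒱 ⟶ 𝔸ⁿ_R` in which the pullback `g^*(dt₁ ∧ ⋯ ∧ dtₙ)` of the
standard gauge form of `𝔸ⁿ` equals `u • ω` for an invertible regular function `u`,
the measure `μ` is the pullback along the chart of the Haar measure `ν` with
density the `p`-adic norm `‖u‖`. -/
def IsWeilMeasure (n : ℕ) [MeasurableSpace (Fin n → ↥k)] (normF : ↥k → ℝ)
    (ν : Measure (Fin n → ↥k)) (ω : GaugeForm k X n)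
    (μ : @Measure (SchemeSection k X) (sectionMeasurableSpace k X)) : Prop :=
  ∀ (𝒱 : X.Opens) (h𝒱 : IsAffineOpen 𝒱) (g : 𝒱.toScheme ⟶ 𝔸(ULift.{u} (Fin n); Spec k)),
    IsEtale g →
    g ≫ (𝔸(ULift.{u} (Fin n); Spec k) ↘ Spec k) = 𝒱.ι ≫ (X ↘ Spec k) →
    ∀ u : (↥Γ(X, 𝒱))ˣ,
      chartWedge k n g = FormsOn.unitSMul k 𝒱 u (ω.form 𝒱 h𝒱) →
      ∀ A : Set (SchemeSection k X), MeasurableSet[sectionMeasurableSpace k X] A →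
        ∀ hA : (∀ s ∈ A, ∀ pt, s.val.base pt ∈ 𝒱),
        Set.InjOn (chartMap k n g) A →
        μ A = ∫⁻ y in chartMap k n g '' A,
          ENNReal.ofReal
            (letI := Classical.propDecidable (∃ s ∈ A, chartMap k n g s = y)
             if hy : ∃ s ∈ A, chartMap k n g s = y
             then normF (secEval k X hy.choose 𝒱
               (hA hy.choose hy.choose_spec.1) (u : ↥Γ(X, 𝒱)))
             else 0) ∂ν

end WeilMeasure

/-- The p-adic norm on the ring of integers of a nonarchimedean field. -/
noncomputable def integerNorm (F : Type) [NontriviallyNormedField F] [IsUltrametricDist F]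
    (x : ↥(integerRing F)) : ℝ := ‖(x : F)‖

end BirGeo

end

open BirGeo

noncomputable instance (F : Type) [NontriviallyNormedField F] [IsUltrametricDist F] :
    TopologicalSpace ↥(RCat F) :=
  inferInstanceAs (TopologicalSpace ↥(integerRing F))

open AlgebraicGeometry CategoryTheory Opposite MeasureTheory BirGeo


theorem exists_unit_of_etale {R B : Type} [CommRing R] [CommRing B] [Algebra R B] (n : ℕ)
    (φ : MvPolynomial (Fin n) R →+* B) (hφ : φ.Etale)
    (hC : φ.comp MvPolynomial.C = algebraMap R B)
    (w : ExteriorAlgebra B (Ω[B⁄R])) (hw : w ∈ ⋀[B]^n (Ω[B⁄R]))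
    (hgen : (⋀[B]^n (Ω[B⁄R]) : Submodule B _) ≤ Submodule.span B {w}) :
    ∃ u : Bˣ, (List.ofFn fun i : Fin n =>
      ExteriorAlgebra.ι B (KaehlerDifferential.D R B (φ (MvPolynomial.X i)))).prod
        = (u : B) • w := by
  classical
  let := φ.toAlgebra
  have : IsScalarTower R (MvPolynomial (Fin n) R) B := IsScalarTower.of_algebraMap_eq' hC.symm
  have : Algebra.Etale (MvPolynomial (Fin n) R) B := hφ
  let e : Module.Basis (Fin n) B (Ω[B⁄R]) :=
    ((KaehlerDifferential.mvPolynomialBasis R (Fin n)).baseChange B).map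
      (KaehlerDifferential.tensorKaehlerEquivOfFormallyEtale R (MvPolynomial (Fin n) R) B)
  have he : ∀ i, e i = KaehlerDifferential.D R B (φ (MvPolynomial.X i)) := by
    intro i
    simp [e]
    rfl
  rw [← ExteriorAlgebra.ιMulti_apply (R := B) (fun i => KaehlerDifferential.D R B (φ (MvPolynomial.X i)))]
  simp_rw [← he]
  have h1 : ∀ v : Fin n → Ω[B⁄R], exteriorPower.ιMulti B n v
      = (e.det v) • exteriorPower.ιMulti B n e := by
    intro v
    let G : (Ω[B⁄R]) [⋀^Fin n]→ₗ[B] (⋀[B]^n (Ω[B⁄R])) :=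
      (LinearMap.toSpanSingleton B _ (exteriorPower.ιMulti B n e)).compAlternatingMap e.det
    have : exteriorPower.ιMulti B n (M := Ω[B⁄R]) = G := by
      apply Module.Basis.ext_alternating e
      intro v hv
      let σ : Equiv.Perm (Fin n) := Equiv.ofBijective v (Finite.injective_iff_bijective.1 hv)
      have : (fun i => e (v i)) = (e ∘ σ) := rfl
      rw [this]
      simp [G, AlternatingMap.map_perm, e.det_self]
    rw [this]; simp [G, LinearMap.toSpanSingleton, e.det_self]
  have hwedge : ExteriorAlgebra.ιMulti B n (e : Fin n → Ω[B⁄R]) ∈ ⋀[B]^n (Ω[B⁄R]) :=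
    (exteriorPower.ιMulti B n e).2
  obtain ⟨a, ha⟩ := Submodule.mem_span_singleton.1 (hgen hwedge)
  have htop : (⟨w, hw⟩ : ⋀[B]^n (Ω[B⁄R])) ∈ Submodule.span B {exteriorPower.ιMulti B n e} := by
    have : (⊤ : Submodule B (⋀[B]^n (Ω[B⁄R]))) ≤ Submodule.span B {exteriorPower.ιMulti B n e} := by
      rw [← exteriorPower.ιMulti_span B n (Ω[B⁄R]), Submodule.span_le]
      rintro _ ⟨v, rfl⟩
      rw [h1 v]
      exact Submodule.smul_mem _ _ (Submodule.mem_span_singleton_self _)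
    exact this trivial
  obtain ⟨b, hb⟩ := Submodule.mem_span_singleton.1 htop
  have hab : (a * b) • exteriorPower.ιMulti B n e = exteriorPower.ιMulti B n e := by
    rw [mul_smul, hb]
    exact Subtype.ext ha
  have hab1 : a * b = 1 := by
    have := congrArg (exteriorPower.alternatingMapLinearEquiv e.det) hab
    simpa [e.det_self] using this
  exact ⟨⟨a, b, hab1, by rw [mul_comm, hab1]⟩, ha.symm⟩


theorem compact_integer (p : ℕ) [Fact p.Prime]
    (F : Type) [NontriviallyNormedField F] [IsUltrametricDist F]
    [Algebra ℚ_[p] F] [FiniteDimensional ℚ_[p] F]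
    (hnorm : ∀ x : ℚ_[p], ‖algebraMap ℚ_[p] F x‖ = ‖x‖) : ProperSpace F := by
  let : NormedSpace ℚ_[p] F :=
    { (inferInstance : Module ℚ_[p] F) with
      norm_smul_le := fun a b => by rw [Algebra.smul_def, norm_mul, hnorm] }
  exact FiniteDimensional.proper ℚ_[p] F

theorem exists_uniformizer 
    (F : Type) [NontriviallyNormedField F] [IsUltrametricDist F] [ProperSpace F] :
    ∃ π : integerRing F, (π : F) ≠ 0 ∧ ‖(π : F)‖ < 1 ∧
      ∀ m : ℕ, ∀ x : integerRing F, x ∈ (BirGeo.maximalIdeal F)^m ↔ ‖(x : F)‖ ≤ ‖(π : F)‖ ^ m := by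
  have hc : IsCompact (Metric.ball (0 : F) 1) :=
    (isCompact_closedBall (0 : F) 1).of_isClosed_subset
      (IsUltrametricDist.isClosed_ball 0 1) Metric.ball_subset_closedBall
  obtain ⟨π, hπ, hmax⟩ := hc.exists_isMaxOn ⟨0, by simp⟩ (continuous_norm.continuousOn)
  have hπ1 : ‖π‖ < 1 := by simpa using hπ
  obtain ⟨y, hy0, hy1⟩ := NormedField.exists_norm_lt_one F
  have hπ0 : π ≠ 0 := by
    rintro rfl
    have := hmax (show y ∈ Metric.ball (0 : F) 1 by simpa using hy1)
    simp at this
    simp [this] at hy0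
  have hp : BirGeo.maximalIdeal F = Ideal.span {(⟨π, hπ1.le⟩ : integerRing F)} := by
    ext x
    rw [Ideal.mem_span_singleton]
    constructor
    · intro hx
      have hx' : ‖(x : F)‖ ≤ ‖π‖ := hmax (show (x : F) ∈ Metric.ball (0 : F) 1 by simpa using! hx)
      refine ⟨⟨(x : F) / π, ?_⟩, ?_⟩
      · show ‖(x : F) / π‖ ≤ 1
        rw [norm_div]; exact div_le_one_of_le₀ hx' (norm_nonneg _)
      · apply Subtype.ext
        show (x : F) = π * (x / π)
        field_simp
    · rintro ⟨c, rfl⟩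
      show ‖π * (c : F)‖ < 1
      rw [norm_mul]
      exact lt_of_le_of_lt (mul_le_of_le_one_right (norm_nonneg _) c.2) hπ1
  refine ⟨⟨π, hπ1.le⟩, hπ0, hπ1, fun m x => ?_⟩
  rw [hp, Ideal.span_singleton_pow, Ideal.mem_span_singleton]
  constructor
  · rintro ⟨c, rfl⟩
    show ‖π ^ m * (c : F)‖ ≤ _
    rw [norm_mul, norm_pow]
    exact mul_le_of_le_one_right (by positivity) c.2
  · intro hx
    have hx : ‖(x : F)‖ ≤ ‖π‖ ^ m := hx
    refine ⟨⟨(x : F) / π ^ m, ?_⟩, ?_⟩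
    · show ‖(x : F) / π ^ m‖ ≤ 1
      rw [norm_div, norm_pow]; exact div_le_one_of_le₀ hx (by positivity)
    · apply Subtype.ext
      show (x : F) = π ^ m * (x / π ^ m)
      field_simp

theorem integer_isAdicComplete 
    (F : Type) [NontriviallyNormedField F] [IsUltrametricDist F] [ProperSpace F] :
    IsAdicComplete (BirGeo.maximalIdeal F) (integerRing F) := by
  obtain ⟨π, hπ0, hπ1, hπ⟩ := exists_uniformizer F
  have hpos : 0 ≤ ‖(π : F)‖ := norm_nonneg _
  have key : ∀ (m : ℕ) (x y : integerRing F),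
      x ≡ y [SMOD (BirGeo.maximalIdeal F ^ m • ⊤ : Submodule (integerRing F) (integerRing F))] ↔
        ‖(x : F) - y‖ ≤ ‖(π : F)‖ ^ m := by
    intro m x y
    rw [SModEq.sub_mem, Ideal.smul_eq_mul, Ideal.mul_top, hπ]
    rfl
  have tend := tendsto_pow_atTop_nhds_zero_of_lt_one hpos hπ1
  refine { haus' := ?_, prec' := ?_ }
  · intro x hx
    apply Subtype.ext
    have h : ∀ m : ℕ, ‖(x : F)‖ ≤ ‖(π : F)‖ ^ m := fun m => by
      simpa using (key m x 0).1 (hx m)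
    have := ge_of_tendsto' tend h
    simpa using this
  · intro f hf
    have hf' : ∀ m k, m ≤ k → ‖(f m : F) - f k‖ ≤ ‖(π : F)‖ ^ m := fun m k h =>
      (key _ _ _).1 (hf h)
    have hcau : CauchySeq (fun m => (f m : F)) := by
      apply cauchySeq_of_le_tendsto_0' (fun m => ‖(π : F)‖ ^ m) _ tend
      intro a b h
      rw [dist_eq_norm]; exact hf' a b h
    obtain ⟨L, hL⟩ := cauchySeq_tendsto_of_complete hcau
    have hL1 : ‖L‖ ≤ 1 := le_of_tendsto' hL.norm (fun m => (f m).2)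
    refine ⟨⟨L, hL1⟩, fun m => ?_⟩
    rw [key]
    refine le_of_tendsto ((tendsto_const_nhds.sub hL).norm) ?_
    filter_upwards [Filter.eventually_ge_atTop m] with k hk using hf' m k hk

theorem integer_iInf
    (F : Type) [NontriviallyNormedField F] [IsUltrametricDist F] [ProperSpace F] :
    ⨅ i, (BirGeo.maximalIdeal F) ^ i = ⊥ := by
  have := integer_isAdicComplete F
  have h := (inferInstance : IsHausdorff (BirGeo.maximalIdeal F) (integerRing F)).iInf_pow_smul
  simpa using h

theorem measure_coset 
    (F : Type) [NontriviallyNormedField F] [IsUltrametricDist F] [Finite (residueRing F)]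
    (n : ℕ)
    [MeasurableSpace (Fin n → ↥(RCat F))] [BorelSpace (Fin n → ↥(RCat F))]
    (ν : Measure (Fin n → ↥(RCat F))) [ν.IsAddHaarMeasure] (hν : ν Set.univ = 1)
    (yb : Fin n → residueRing F) :
    ν {y | ∀ i, residueCat F (y i) = yb i} = ((Nat.card (residueRing F) : ENNReal) ^ n)⁻¹ := by
  have : ContinuousAdd (RCat F) := inferInstanceAs (ContinuousAdd (integerRing F))
  let ψ : (Fin n → ↥(RCat F)) →+ (Fin n → residueRing F) :=
    AddMonoidHom.pi (fun i => ((residueCat F).hom.toAddMonoidHom).comp (Pi.evalAddMonoidHom _ i))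
  have hs : Function.Surjective ψ := by
    intro z
    choose y hy using fun i => Ideal.Quotient.mk_surjective (I := BirGeo.maximalIdeal F) (z i)
    exact ⟨y, funext hy⟩
  have hopen : IsOpen (ψ.ker : Set (Fin n → ↥(RCat F))) := by
    have : (ψ.ker : Set (Fin n → ↥(RCat F))) =
      ⋂ i, (fun y : Fin n → ↥(RCat F) => y i) ⁻¹' {x : RCat F | integerNorm F x < 1} := by
      ext y
      simp only [SetLike.mem_coe, AddMonoidHom.mem_ker, Set.mem_iInter, Set.mem_preimage]
      rw [funext_iff]
      refine forall_congr' fun i => ?_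
      exact Ideal.Quotient.eq_zero_iff_mem (I := BirGeo.maximalIdeal F) (a := y i)
    rw [this]
    refine isOpen_iInter_of_finite fun i => IsOpen.preimage (continuous_apply i) ?_
    have : Continuous (integerNorm F) := continuous_norm.comp continuous_subtype_val
    exact this.isOpen_preimage _ isOpen_Iio
  have hidx : ψ.ker.index = Nat.card (residueRing F) ^ n := by
    rw [AddSubgroup.index_ker, AddMonoidHom.range_eq_top.2 hs]
    simp [Nat.card_fun]
  have hq : Nat.card (residueRing F) ≠ 0 := by
    have : Nonempty (residueRing F) := ⟨0⟩
    exact Nat.card_pos.ne'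
  have : ψ.ker.FiniteIndex := ⟨by rw [hidx]; exact pow_ne_zero _ hq⟩
  have h := AddSubgroup.index_mul_measure ψ.ker hopen.measurableSet ν
  rw [hidx, hν] at h
  obtain ⟨y0, hy0⟩ := hs yb
  have hset : {y | ∀ i, residueCat F (y i) = yb i} = (fun y => -y0 + y) ⁻¹' (ψ.ker : Set (Fin n → ↥(RCat F))) := by
    ext y
    simp only [Set.mem_setOf_eq, Set.mem_preimage, SetLike.mem_coe, AddMonoidHom.mem_ker, map_add, map_neg, hy0]
    rw [neg_add_eq_zero, funext_iff]
    exact forall_congr' fun i => eq_comm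
  rw [hset, measure_preimage_add]
  apply ENNReal.eq_inv_of_mul_eq_one_left
  rw [mul_comm]
  exact_mod_cast h


noncomputable def evHom {X : Scheme.{0}} {K : CommRingCat.{0}} (t : Spec K ⟶ X) (U : X.Opens)
    (h : (⊤ : (Spec K).Opens) ≤ t ⁻¹ᵁ U) : Γ(X, U) ⟶ K :=
  t.appLE U ⊤ h ≫ (Scheme.ΓSpecIso K).hom

theorem evHom_fromSpec {X : Scheme.{0}} {K : CommRingCat.{0}} (t : Spec K ⟶ X) {U : X.Opens}
    (hU : IsAffineOpen U) (h : (⊤ : (Spec K).Opens) ≤ t ⁻¹ᵁ U) :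
    Spec.map (evHom t U h) ≫ hU.fromSpec = t := by
  rw [evHom, Spec.map_comp, Category.assoc,
    IsAffineOpen.SpecMap_appLE_fromSpec t hU (isAffineOpen_top _) h, IsAffineOpen.fromSpec_top,
    Scheme.isoSpec_Spec_inv, ← Category.assoc, ← Spec.map_comp]
  simp

theorem fromSpec_le {X : Scheme.{0}} {K : CommRingCat.{0}} {U : X.Opens}
    (hU : IsAffineOpen U) (α : Γ(X, U) ⟶ K) :
    (⊤ : (Spec K).Opens) ≤ (Spec.map α ≫ hU.fromSpec) ⁻¹ᵁ U := by
  intro x _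
  have : hU.fromSpec ((Spec.map α) x) ∈ (U : Set X) := by
    rw [← hU.range_fromSpec]; exact ⟨_, rfl⟩
  simp

theorem evHom_unique {X : Scheme.{0}} {K : CommRingCat.{0}} (t : Spec K ⟶ X) {U : X.Opens}
    (hU : IsAffineOpen U) (h : (⊤ : (Spec K).Opens) ≤ t ⁻¹ᵁ U) (α : Γ(X, U) ⟶ K)
    (hα : Spec.map α ≫ hU.fromSpec = t) : evHom t U h = α := by
  apply Spec.map_injective
  rw [← cancel_mono hU.fromSpec, evHom_fromSpec t hU h, hα]

theorem fromSpec_over (k : CommRingCat.{0}) (X : Scheme.{0}) [X.Over (Spec k)] {U : X.Opens}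
    (hU : IsAffineOpen U) :
    hU.fromSpec ≫ (X ↘ Spec k) = Spec.map (CommRingCat.ofHom (secHom k X U)) := by
  have h := IsAffineOpen.SpecMap_appLE_fromSpec (X ↘ Spec k) (isAffineOpen_top _) hU
    (fun _ _ => trivial)
  rw [← h, IsAffineOpen.fromSpec_top, Scheme.isoSpec_Spec_inv, ← Spec.map_comp]
  rfl

theorem over_iff (k : CommRingCat.{0}) (X : Scheme.{0}) [X.Over (Spec k)] {U : X.Opens}
    (hU : IsAffineOpen U) {K : CommRingCat.{0}} (α : Γ(X, U) ⟶ K) (r : k ⟶ K) :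
    (Spec.map α ≫ hU.fromSpec) ≫ (X ↘ Spec k) = Spec.map r ↔
      CommRingCat.ofHom (secHom k X U) ≫ α = r := by
  rw [Category.assoc, fromSpec_over, ← Spec.map_comp]
  exact ⟨fun h => Spec.map_injective h, fun h => by rw [h]⟩

theorem secEval_eq (k : CommRingCat.{0}) (X : Scheme.{0}) [X.Over (Spec k)]
    (s : SchemeSection k X) (U : X.Opens) (h : ∀ pt, s.val.base pt ∈ U) (g : Γ(X, U)) :
    secEval k X s U h g = evHom s.val U (fun pt _ => h pt) g := by
  rfl

theorem exists_chart (k : CommRingCat.{0}) (X : Scheme.{0}) [X.Over (Spec k)] {U : X.Opens}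
    (hU : IsAffineOpen U) (n : ℕ) (φ : MvPolynomial (Fin n) k →+* Γ(X, U)) (hφ : φ.Etale)
    (hC : φ.comp MvPolynomial.C = secHom k X U) :
    ∃ g : U.toScheme ⟶ 𝔸(ULift.{0} (Fin n); Spec k), IsEtale g ∧
      g ≫ (𝔸(ULift.{0} (Fin n); Spec k) ↘ Spec k) = U.ι ≫ (X ↘ Spec k) ∧
      ∀ i, chartCoord k n g i = φ (MvPolynomial.X i) := by
  let ρ : MvPolynomial (ULift.{0} (Fin n)) k →+* Γ(X, U) :=
    φ.comp (MvPolynomial.renameEquiv k Equiv.ulift).toRingEquiv.toRingHom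
  have hρ : ρ.Etale := RingHom.Etale.respectsIso.2 _ _ hφ
  have h1 : Etale (Spec.map (CommRingCat.ofHom ρ)) :=
    (HasRingHomProperty.Spec_iff (P := @Etale)).2 hρ
  refine ⟨hU.isoSpec.hom ≫ Spec.map (CommRingCat.ofHom ρ) ≫ (AffineSpace.SpecIso _ k).inv, ?_, ?_, ?_⟩
  · show Etale _
    infer_instance
  · simp only [Category.assoc]
    rw [AffineSpace.SpecIso_inv_over, ← Spec.map_comp]
    rw [← hU.isoSpec_hom_fromSpec, Category.assoc, fromSpec_over]
    congr 2
    rw [← hC]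
    ext x
    simp [ρ]
  · intro i
    have : (CommRingCat.ofHom ρ) (MvPolynomial.X (ULift.up i)) = φ (MvPolynomial.X i) := by
      simp [ρ]
    rw [← this]
    have e0 : (Scheme.ΓSpecIso _).inv ≫ (Spec.map (CommRingCat.ofHom ρ)).appTop ≫
        hU.isoSpec.hom.appTop ≫ U.topIso.hom = CommRingCat.ofHom ρ := by
      have q : hU.isoSpec.hom.appTop ≫ U.topIso.hom = (Scheme.ΓSpecIso Γ(X, U)).hom := by
        rw [hU.isoSpec_hom_appTop, Category.assoc, Iso.inv_hom_id, Category.comp_id]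
      rw [q, ← Category.assoc]
      erw [← Scheme.ΓSpecIso_inv_naturality (CommRingCat.ofHom ρ)]
      rw [Category.assoc]
      erw [Iso.inv_hom_id]
      rfl
    have e1 : (hU.isoSpec.hom ≫ Spec.map (CommRingCat.ofHom ρ) ≫
        (AffineSpace.SpecIso _ k).inv).appTop = (AffineSpace.SpecIso _ k).inv.appTop ≫
          (Spec.map (CommRingCat.ofHom ρ)).appTop ≫ hU.isoSpec.hom.appTop := by
      rw [Scheme.Hom.comp_appTop, Scheme.Hom.comp_appTop, Category.assoc]
    have e2 := AffineSpace.SpecIso_inv_appTop_coord (n := ULift.{0} (Fin n)) k (ULift.up i)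
    have e3 := congrArg (fun z => U.topIso.hom (hU.isoSpec.hom.appTop
      ((Spec.map (CommRingCat.ofHom ρ)).appTop z))) e2
    have e4 := congrArg (fun f => f.hom (MvPolynomial.X (ULift.up i))) e0
    refine Eq.trans ?_ (e3.trans e4)
    exact congrArg (fun f => U.topIso.hom (f.hom (AffineSpace.coord (Spec k) (ULift.up i)))) e1


theorem etale_lift_exists {R B : Type} [CommRing R] [CommRing B] (I : Ideal R) [IsAdicComplete I R]
    {n : ℕ} (φ : MvPolynomial (Fin n) R →+* B) (hφ : φ.Etale) (αb : B →+* R ⧸ I)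
    (hαb : αb.comp (φ.comp MvPolynomial.C) = Ideal.Quotient.mk I) (y : Fin n → R)
    (hy : ∀ i, Ideal.Quotient.mk I (y i) = αb (φ (MvPolynomial.X i))) :
    ∃ α : B →+* R, α.comp (φ.comp MvPolynomial.C) = RingHom.id R ∧
      (∀ i, α (φ (MvPolynomial.X i)) = y i) ∧ (Ideal.Quotient.mk I).comp α = αb := by
  let := φ.toAlgebra
  have : Algebra.Etale (MvPolynomial (Fin n) R) B := hφ
  let : Algebra (MvPolynomial (Fin n) R) R := (MvPolynomial.eval y).toAlgebra
  have hcomp : (Ideal.Quotient.mk I).comp (MvPolynomial.eval y) = αb.comp φ := by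
    apply MvPolynomial.ringHom_ext
    · intro r
      have := congr($hαb r)
      simpa using this.symm
    · intro i; simpa using hy i
  let f : B →ₐ[MvPolynomial (Fin n) R] R ⧸ I :=
    { αb with commutes' := fun r => congr($hcomp.symm r) }
  obtain ⟨g, hg⟩ := Algebra.FormallySmooth.exists_mkₐ_comp_eq_of_isAdicComplete f
  have hgc : ∀ r, g (φ r) = MvPolynomial.eval y r := fun r => g.commutes r
  refine ⟨g.toRingHom, ?_, ?_, ?_⟩
  · ext r; simpa using hgc (MvPolynomial.C r)
  · intro i; simpa using hgc (MvPolynomial.X i)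
  · ext b; exact congr($hg b)

theorem etale_lift_unique {R B : Type} [CommRing R] [CommRing B] (I : Ideal R)
    (hI : ⨅ i, I ^ i = ⊥)
    {n : ℕ} (φ : MvPolynomial (Fin n) R →+* B) (hφ : φ.Etale) (α₁ α₂ : B →+* R)
    (h1 : α₁.comp (φ.comp MvPolynomial.C) = RingHom.id R)
    (h2 : α₂.comp (φ.comp MvPolynomial.C) = RingHom.id R)
    (hX : ∀ i, α₁ (φ (MvPolynomial.X i)) = α₂ (φ (MvPolynomial.X i)))
    (hm : (Ideal.Quotient.mk I).comp α₁ = (Ideal.Quotient.mk I).comp α₂) : α₁ = α₂ := by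
  let := φ.toAlgebra
  have : Algebra.Etale (MvPolynomial (Fin n) R) B := hφ
  let : Algebra (MvPolynomial (Fin n) R) R := (α₁.comp φ).toAlgebra
  have hcomp : α₂.comp φ = α₁.comp φ := by
    apply MvPolynomial.ringHom_ext
    · intro r
      exact congr($h2 r).trans congr($h1 r).symm
    · intro i; exact (hX i).symm
  let f1 : B →ₐ[MvPolynomial (Fin n) R] R := { α₁ with commutes' := fun r => rfl }
  let f2 : B →ₐ[MvPolynomial (Fin n) R] R := { α₂ with commutes' := fun r => congr($hcomp r) }
  have h : f1 = f2 := Algebra.FormallyUnramified.ext_of_iInf I hI (fun x => congr($hm x))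
  ext b
  exact congr($h b)

theorem exists_finite_gens {R B : Type} [CommRing R] [CommRing B] {n : ℕ}
    (φ : MvPolynomial (Fin n) R →+* B) (hφ : φ.Etale) :
    ∃ (m : ℕ) (b : Fin m → B), ∀ (K : Type) [CommRing K] (β₁ β₂ : B →+* K),
      β₁.comp (φ.comp MvPolynomial.C) = β₂.comp (φ.comp MvPolynomial.C) →
      (∀ i, β₁ (b i) = β₂ (b i)) → β₁ = β₂ := by
  have hft : (φ.comp MvPolynomial.C).FiniteType := by
    have h1 : φ.FiniteType := by
      let := φ.toAlgebra
      have : Algebra.Etale (MvPolynomial (Fin n) R) B := hφ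
      exact (inferInstance : Algebra.FiniteType (MvPolynomial (Fin n) R) B)
    have h2 : (MvPolynomial.C : R →+* MvPolynomial (Fin n) R).FiniteType := by
      have : (algebraMap R (MvPolynomial (Fin n) R)).FiniteType :=
        RingHom.finiteType_algebraMap.2 inferInstance
      exact this
    exact h1.comp h2
  let := (φ.comp MvPolynomial.C).toAlgebra
  have : Algebra.FiniteType R B := hft
  obtain ⟨m, f, hf⟩ := Algebra.FiniteType.iff_quotient_mvPolynomial''.1 this
  refine ⟨m, fun i => f (MvPolynomial.X i), fun K _ β₁ β₂ hC hX => ?_⟩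
  have : β₁.comp f.toRingHom = β₂.comp f.toRingHom := by
    apply MvPolynomial.ringHom_ext
    · intro r
      have : f (MvPolynomial.C r) = φ (MvPolynomial.C r) := f.commutes r
      simpa [this] using congr($hC r)
    · intro i; exact hX i
  ext b
  obtain ⟨a, rfl⟩ := hf b
  exact congr($this a)

theorem isUnit_of_not_mem (F : Type) [NontriviallyNormedField F] [IsUltrametricDist F]
    (x : integerRing F) (hx : x ∉ BirGeo.maximalIdeal F) : IsUnit x := by
  have h1 : ‖(x : F)‖ = 1 := le_antisymm x.2 (not_lt.1 hx)
  have h0 : (x : F) ≠ 0 := by rintro h; simp [h] at h1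
  exact IsUnit.of_mul_eq_one ⟨(x : F)⁻¹, by show ‖(x : F)⁻¹‖ ≤ 1; rw [norm_inv, h1]; simp⟩
    (Subtype.ext (mul_inv_cancel₀ h0))

theorem norm_of_isUnit (F : Type) [NontriviallyNormedField F] [IsUltrametricDist F]
    (x : integerRing F) (hx : IsUnit x) : integerNorm F x = 1 := by
  obtain ⟨u, rfl⟩ := hx
  refine le_antisymm (u : integerRing F).2 ?_
  have h : ((u : integerRing F) : F) * ((u⁻¹ : (integerRing F)ˣ) : integerRing F) = 1 :=
    congrArg Subtype.val u.mul_inv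
  have h2 := congrArg norm h
  rw [norm_mul, norm_one] at h2
  rw [← h2]
  exact mul_le_of_le_one_right (norm_nonneg _) ((u⁻¹ : (integerRing F)ˣ) : integerRing F).2

theorem maximalIdeal_isMaximal (F : Type) [NontriviallyNormedField F] [IsUltrametricDist F] :
    (BirGeo.maximalIdeal F).IsMaximal := by
  rw [Ideal.isMaximal_iff]
  refine ⟨fun h => ?_, fun J x _ hx hxJ => ?_⟩
  · have : ‖((1 : integerRing F) : F)‖ < 1 := h
    simp at this
  · exact (Ideal.eq_top_iff_one _).1 (Ideal.eq_top_of_isUnit_mem _ hxJ (isUnit_of_not_mem F x hx))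

theorem unique_spec_residue (F : Type) [NontriviallyNormedField F] [IsUltrametricDist F] :
    Nonempty (Unique (Spec (CommRingCat.of (residueRing F)))) := by
  have := maximalIdeal_isMaximal F
  let : Field (residueRing F) := Ideal.Quotient.field (BirGeo.maximalIdeal F)
  exact ⟨(inferInstance : Unique (PrimeSpectrum (residueRing F)))⟩

theorem closed_open (F : Type) [NontriviallyNormedField F] [IsUltrametricDist F]
    (W : (Spec (RCat F)).Opens) (z : Spec (CommRingCat.of (residueRing F)))
    (hz : Spec.map (residueCat F) z ∈ W) : W = ⊤ := by
  rw [eq_top_iff]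
  intro y _
  have hsp : (y : PrimeSpectrum (integerRing F)) ⤳ (Spec.map (residueCat F) z : PrimeSpectrum (integerRing F)) := by
    refine (PrimeSpectrum.le_iff_specializes (R := integerRing F) y (Spec.map (residueCat F) z)).1 ?_
    intro a ha
    have ha' : a ∈ BirGeo.maximalIdeal F := by
      by_contra hn
      exact y.isPrime.ne_top (Ideal.eq_top_of_isUnit_mem _ ha (isUnit_of_not_mem F a hn))
    have h0 : (residueCat F) a = 0 :=
      (Ideal.Quotient.eq_zero_iff_mem (I := BirGeo.maximalIdeal F) (a := (show integerRing F from a))).2 ha'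
    show (residueCat F) a ∈ z.asIdeal
    rw [h0]; exact zero_mem _
  exact hsp.mem_open W.2 hz


theorem exists_etale_nhd (F : Type) [NontriviallyNormedField F] [IsUltrametricDist F]
    (n : ℕ) (X : Scheme.{0}) [X.Over (Spec (RCat F))]
    [SmoothOfRelativeDimension n (X ↘ Spec (RCat F))]
    (t : Spec (CommRingCat.of (residueRing F)) ⟶ X)
    (ht : t ≫ (X ↘ Spec (RCat F)) = Spec.map (residueCat F)) :
    ∃ (V : X.Opens) (_ : IsAffineOpen V) (_ : (⊤ : (Spec (CommRingCat.of (residueRing F))).Opens) ≤ t ⁻¹ᵁ V)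
      (φ : MvPolynomial (Fin n) (RCat F) →+* Γ(X, V)),
      φ.Etale ∧ φ.comp MvPolynomial.C = secHom (RCat F) X V := by
  obtain ⟨inst⟩ := unique_spec_residue F
  let z : Spec (CommRingCat.of (residueRing F)) := default
  obtain ⟨U, hU, V, hV, hx, e, hst⟩ :=
    SmoothOfRelativeDimension.exists_isStandardSmoothOfRelativeDimension
      (n := n) (f := X ↘ Spec (RCat F)) (t z)
  have hz : Spec.map (residueCat F) z ∈ U := by
    rw [← ht]
    exact e hx
  obtain rfl := closed_open F U z hz
  refine ⟨V, hV, ?_, ?_⟩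
  · intro z' _
    rw [Subsingleton.elim z' z]
    exact hx
  · have h2 : (secHom (RCat F) X V).IsStandardSmoothOfRelativeDimension n := by
      have := RingHom.isStandardSmoothOfRelativeDimension_respectsIso (n := n) |>.2
        ((X ↘ Spec (RCat F)).appLE ⊤ V e).hom
        ((Scheme.ΓSpecIso (RCat F)).symm.commRingCatIsoToRingEquiv) hst
      exact this
    obtain ⟨g, hg, hg2⟩ := h2.exists_etale_mvPolynomial
    exact ⟨g, hg2, hg⟩

theorem chartMap_eq (k : CommRingCat.{0}) (X : Scheme.{0}) [X.Over (Spec k)] (n : ℕ)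
    [TopologicalSpace ↥k] {V : X.Opens}
    (g : V.toScheme ⟶ 𝔸(ULift.{0} (Fin n); Spec k))
    (s : SchemeSection k X) (h : (⊤ : (Spec k).Opens) ≤ s.val ⁻¹ᵁ V) (i : Fin n) :
    chartMap k n g s i = evHom s.val V h (chartCoord k n g i) := by
  have h' : ∀ pt, s.val.base pt ∈ V := fun pt => h trivial
  have e : chartMap k n g s = fun i => secEval k X s V h' (chartCoord k n g i) := dif_pos h'
  rw [e]
  exact secEval_eq k X s V h' _

set_option maxHeartbeats 400000 in
theorem main_thm
    (F : Type) [NontriviallyNormedField F] [IsUltrametricDist F] [ProperSpace F]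
    [Finite (residueRing F)]
    (n : ℕ) (X : Scheme.{0}) [X.Over (Spec (RCat F))]
    [SmoothOfRelativeDimension n (X ↘ Spec (RCat F))]
    (ω : GaugeForm (RCat F) X n)
    [MeasurableSpace (Fin n → ↥(RCat F))] [BorelSpace (Fin n → ↥(RCat F))]
    (ν : Measure (Fin n → ↥(RCat F))) [ν.IsAddHaarMeasure] (hν : ν Set.univ = 1)
    (μ : @Measure (SchemeSection (RCat F) X) (sectionMeasurableSpace (RCat F) X))
    (hμ : IsWeilMeasure (RCat F) n (integerNorm F) ν ω μ)
    (t : Spec (CommRingCat.of (residueRing F)) ⟶ X)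
    (ht : t ≫ (X ↘ Spec (RCat F)) = Spec.map (residueCat F)) :
    μ { s : SchemeSection (RCat F) X | Spec.map (residueCat F) ≫ s.val = t } =
      ((Nat.card (residueRing F) : ENNReal) ^ n)⁻¹ := by
  obtain ⟨V, hV, htV, φ, hφ, hC⟩ := exists_etale_nhd F n X t ht
  obtain ⟨inst⟩ := unique_spec_residue F
  obtain ⟨g, hg1, hg2, hg3⟩ := exists_chart (RCat F) X hV n φ hφ hC
  -- the reduced point
  let αb := evHom t V htV
  have hαb : Spec.map αb ≫ hV.fromSpec = t := evHom_fromSpec t hV htV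
  have hαbC : CommRingCat.ofHom (secHom (RCat F) X V) ≫ αb = residueCat F := by
    rw [← over_iff (RCat F) X hV, hαb, ht]
  let A : Set (SchemeSection (RCat F) X) := { s | Spec.map (residueCat F) ≫ s.val = t }
  have hA' : ∀ s ∈ A, (⊤ : (Spec (RCat F)).Opens) ≤ s.val ⁻¹ᵁ V := by
    intro s hs
    have hs : Spec.map (residueCat F) ≫ s.val = t := hs
    have : Spec.map (residueCat F) (default : Spec (CommRingCat.of (residueRing F))) ∈ s.val ⁻¹ᵁ V := by
      have h := htV (show (default : Spec (CommRingCat.of (residueRing F))) ∈ ⊤ from trivial)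
      rw [← hs] at h
      exact h
    rw [closed_open F _ _ this]
  have hA : ∀ s ∈ A, ∀ pt, s.val.base pt ∈ V := fun s hs pt => hA' s hs trivial
  have hsec : ∀ (s : SchemeSection (RCat F) X) (h : (⊤ : (Spec (RCat F)).Opens) ≤ s.val ⁻¹ᵁ V),
      CommRingCat.ofHom (secHom (RCat F) X V) ≫ evHom s.val V h = 𝟙 (RCat F) := by
    intro s h
    exact (over_iff (RCat F) X hV (evHom s.val V h) (𝟙 (RCat F))).1
      (by rw [evHom_fromSpec s.val hV h, s.2, Spec.map_id])
  have hred : ∀ (s : SchemeSection (RCat F) X) (h : (⊤ : (Spec (RCat F)).Opens) ≤ s.val ⁻¹ᵁ V),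
      s ∈ A ↔ evHom s.val V h ≫ residueCat F = αb := by
    intro s h
    constructor
    · intro hs
      refine (evHom_unique t hV htV _ ?_).symm
      rw [Spec.map_comp, Category.assoc, evHom_fromSpec]; exact hs
    · intro hs
      show Spec.map (residueCat F) ≫ s.val = t
      rw [← hαb, ← hs, Spec.map_comp, Category.assoc, evHom_fromSpec]
  have hchart : ∀ (s : SchemeSection (RCat F) X) (h : (⊤ : (Spec (RCat F)).Opens) ≤ s.val ⁻¹ᵁ V) (i : Fin n),
      chartMap (RCat F) n g s i = evHom s.val V h (φ (MvPolynomial.X i)) := by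
    intro s h i
    rw [chartMap_eq, hg3]
  -- injectivity
  have hinj : Set.InjOn (chartMap (RCat F) n g) A := by
    intro s1 h1 s2 h2 h12
    have e1 := hA' s1 h1
    have e2 := hA' s2 h2
    have key : (evHom s1.val V e1).hom = (evHom s2.val V e2).hom := by
      refine etale_lift_unique (BirGeo.maximalIdeal F) (integer_iInf F) φ hφ _ _ ?_ ?_ ?_ ?_
      · have q : (evHom s1.val V e1).hom.comp (φ.comp MvPolynomial.C) = RingHom.id (RCat F) := by
          rw [hC]; exact congrArg CommRingCat.Hom.hom (hsec s1 e1)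
        exact q
      · have q : (evHom s2.val V e2).hom.comp (φ.comp MvPolynomial.C) = RingHom.id (RCat F) := by
          rw [hC]; exact congrArg CommRingCat.Hom.hom (hsec s2 e2)
        exact q
      · intro i
        have := congrFun h12 i
        rw [hchart s1 e1, hchart s2 e2] at this
        exact this
      · exact congrArg CommRingCat.Hom.hom (((hred s1 e1).1 h1).trans ((hred s2 e2).1 h2).symm)
    apply Subtype.ext
    rw [← evHom_fromSpec s1.val hV e1, ← evHom_fromSpec s2.val hV e2]
    rw [show evHom s1.val V e1 = evHom s2.val V e2 from CommRingCat.hom_ext key]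
  -- image
  have himg : chartMap (RCat F) n g '' A =
      {y | ∀ i, residueCat F (y i) = αb (φ (MvPolynomial.X i))} := by
    ext y
    constructor
    · rintro ⟨s, hs, rfl⟩ i
      rw [hchart s (hA' s hs)]
      exact congr($((hred s (hA' s hs)).1 hs).hom (φ (MvPolynomial.X i)))
    · intro hy
      have := integer_isAdicComplete F
      have q : αb.hom.comp (φ.comp MvPolynomial.C) = (residueCat F).hom := by
        rw [hC]; exact congrArg CommRingCat.Hom.hom hαbC
      obtain ⟨α, hα1, hα2, hα3⟩ := etale_lift_exists (BirGeo.maximalIdeal F) φ hφ αb.hom q y hy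
      let a : Γ(X, V) ⟶ RCat F := CommRingCat.ofHom α
      let s : SchemeSection (RCat F) X := ⟨Spec.map a ≫ hV.fromSpec, by
        rw [← Spec.map_id, over_iff]
        have q2 : a.hom.comp (φ.comp MvPolynomial.C) = RingHom.id (RCat F) := hα1
        rw [hC] at q2
        exact CommRingCat.hom_ext q2⟩
      have hsV : (⊤ : (Spec (RCat F)).Opens) ≤ s.val ⁻¹ᵁ V := fromSpec_le hV a
      have hev : evHom s.val V hsV = a := evHom_unique _ hV _ _ rfl
      refine ⟨s, (hred s hsV).2 ?_, ?_⟩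
      · rw [hev]; exact CommRingCat.hom_ext hα3
      · funext i
        rw [hchart s hsV, hev]
        exact hα2 i
  -- measurability
  have hresopen : ∀ c : residueRing F, IsOpen {x : RCat F | residueCat F x = c} := by
    intro c
    obtain ⟨x0, rfl⟩ := Ideal.Quotient.mk_surjective (I := BirGeo.maximalIdeal F) c
    have : {x : RCat F | residueCat F x = Ideal.Quotient.mk (BirGeo.maximalIdeal F) x0}
        = (fun x : integerRing F => ‖(x : F) - x0‖) ⁻¹' Set.Iio 1 := by
      ext x
      exact Ideal.Quotient.mk_eq_mk_iff_sub_mem (I := BirGeo.maximalIdeal F) x x0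
    rw [this]
    have hcont : Continuous (fun x : integerRing F => ‖(x : F) - x0‖) := by fun_prop
    exact hcont.isOpen_preimage _ isOpen_Iio
  have hmeas : MeasurableSet[sectionMeasurableSpace (RCat F) X] A := by
    obtain ⟨m, b, hb⟩ := exists_finite_gens φ hφ
    let T : Option (Fin m) → Set (SchemeSection (RCat F) X) := fun j =>
      match j with
      | none => { s | ∃ h : ∀ pt, s.val.base pt ∈ V, secEval (RCat F) X s V h 1 ∈ Set.univ }
      | some i => { s | ∃ h : ∀ pt, s.val.base pt ∈ V,
          secEval (RCat F) X s V h (b i) ∈ {x : RCat F | residueCat F x = αb (b i)} }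
    have hT : ∀ j, @IsOpen _ (sectionTopology (RCat F) X) (T j) := by
      intro j
      apply TopologicalSpace.isOpen_generateFrom_of_mem
      cases j with
      | none => exact ⟨V, 1, Set.univ, isOpen_univ, rfl⟩
      | some i => exact ⟨V, b i, _, hresopen _, rfl⟩
    have hAT : A = ⋂ j, T j := by
      ext s
      rw [Set.mem_iInter]
      constructor
      · rintro hs (_ | i)
        · exact ⟨hA s hs, trivial⟩
        · refine ⟨hA s hs, ?_⟩
          show residueCat F (secEval (RCat F) X s V (hA s hs) (b i)) = _
          rw [secEval_eq]
          exact congr($((hred s (hA' s hs)).1 hs).hom (b i))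
      · intro hs
        obtain ⟨h, -⟩ := hs none
        have h' : (⊤ : (Spec (RCat F)).Opens) ≤ s.val ⁻¹ᵁ V := fun pt _ => h pt
        rw [hred s h']
        apply CommRingCat.hom_ext
        refine hb _ _ _ ?_ ?_
        · rw [hC]
          have : CommRingCat.ofHom (secHom (RCat F) X V) ≫ evHom s.val V h' ≫ residueCat F
              = CommRingCat.ofHom (secHom (RCat F) X V) ≫ αb := by
            rw [hαbC, ← Category.assoc, hsec]
            exact Category.id_comp (residueCat F)
          exact congrArg CommRingCat.Hom.hom this
        · intro i
          obtain ⟨h2, h3⟩ := hs (some i)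
          rw [secEval_eq] at h3
          exact h3
    let τ : TopologicalSpace (SchemeSection (RCat F) X) := sectionTopology (RCat F) X
    have hAo : IsOpen A := by
      rw [hAT]; exact isOpen_iInter_of_finite hT
    exact MeasurableSpace.measurableSet_generateFrom hAo
  -- unit
  obtain ⟨u, hu⟩ : ∃ u : (Γ(X, V))ˣ,
      chartWedge (RCat F) n g = FormsOn.unitSMul (RCat F) V u (ω.form V hV) := by
    let := secAlgebra (RCat F) X V
    obtain ⟨u, hu⟩ := exists_unit_of_etale n φ hφ hC (ω.form V hV) (ω.isDegree V hV)
      (ω.generates V hV)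
    refine ⟨u, Eq.trans ?_ hu⟩
    unfold chartWedge
    simp only [hg3]
    rfl
  have hfin := hμ V hV g hg1 hg2 u hu A hmeas hA hinj
  show μ A = _
  rw [hfin]
  have himeas : MeasurableSet (chartMap (RCat F) n g '' A) := by
    rw [himg]
    have : {y : Fin n → RCat F | ∀ i, residueCat F (y i) = αb (φ (MvPolynomial.X i))}
      = ⋂ i, (fun y : Fin n → RCat F => y i) ⁻¹' {x | residueCat F x = αb (φ (MvPolynomial.X i))} := by
      ext y; simp
    rw [this]
    exact (isOpen_iInter_of_finite fun i => (hresopen _).preimage (continuous_apply i)).measurableSet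
  rw [setLIntegral_congr_fun (g := fun _ => 1) himeas]
  · rw [setLIntegral_one, himg]
    exact measure_coset F n ν hν _
  · intro y hy
    have hy' : ∃ s ∈ A, chartMap (RCat F) n g s = y := hy
    simp only
    rw [dif_pos hy', secEval_eq]
    exact (congrArg ENNReal.ofReal
      (norm_of_isUnit F _ (u.isUnit.map (evHom hy'.choose.val V _).hom))).trans ENNReal.ofReal_one


theorem weil_measure_of_fiber_of_reduction_map
    -- F is a local number field with ring of integers R, maximal ideal 𝔮 and
    -- finite residue field F_𝔮 = R/𝔮 of cardinality q = Nat.card (residueRing F):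
    (p : ℕ) [Fact p.Prime]
    (F : Type) [NontriviallyNormedField F] [IsUltrametricDist F]
    [Algebra ℚ_[p] F] [FiniteDimensional ℚ_[p] F]
    (hnorm : ∀ x : ℚ_[p], ‖algebraMap ℚ_[p] F x‖ = ‖x‖)
    [Finite (residueRing F)]
    -- 𝒳 is a regular scheme over S = Spec R, (smooth) of relative dimension n:
    (n : ℕ) (X : Scheme.{0}) [X.Over (Spec (RCat F))]
    [SmoothOfRelativeDimension n (X ↘ Spec (RCat F))]
    -- ω is a gauge form on 𝒳:
    (ω : GaugeForm (RCat F) X n)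
    -- ν is the Haar measure on Rⁿ = 𝔸ⁿ(R) normalized so that ν(Rⁿ) = 1:
    [MeasurableSpace (Fin n → ↥(RCat F))] [BorelSpace (Fin n → ↥(RCat F))]
    (ν : Measure (Fin n → ↥(RCat F))) [ν.IsAddHaarMeasure] (hν : ν Set.univ = 1)
    -- μ is the Weil p-adic measure dμ_ω associated with ω:
    (μ : @Measure (SchemeSection (RCat F) X) (sectionMeasurableSpace (RCat F) X))
    (hμ : IsWeilMeasure (RCat F) n (integerNorm F) ν ω μ)
    -- x̄ is a closed F_𝔮-point of 𝒳:
    (xbar : { t : Spec (CommRingCat.of (residueRing F)) ⟶ X //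
        t ≫ (X ↘ Spec (RCat F)) = Spec.map (residueCat F) }) :
    -- the fiber of the reduction map φ : 𝒳(R) → 𝒳(F_𝔮) over x̄ has measure q⁻ⁿ:
    μ { s : SchemeSection (RCat F) X | Spec.map (residueCat F) ≫ s.val = xbar.val } =
      ((Nat.card (residueRing F) : ENNReal) ^ n)⁻¹ := by
  have := compact_integer p F hnorm
  exact main_thm F n X ω ν hν μ hμ xbar.val xbar.2
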